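/- Let n ≥ 3 and let F be a face of the Whitehouse complex Δ_n. Then the link of F in Δ_n is isomorphic, as a simplicial complex, to the join Δ_{c+1} * (the join over all T ∈ F of Δ_{c(T)+1}), where c is the number of components of the forest representation of F and c(T) is the number of children of the node T in the forest representation of F, and the joined Whitehouse complexes are taken on pairwise disjoint vertex sets. -/

import Mathlib

/-- `F` is a face of the Whitehouse complex `Δ_n`. -/
def IsWhFace (n : ℕ) (F : Finset (Finset ℕ)) : Prop :=
  (∀ S ∈ F, S ⊆ Finset.Icc 2 n ∧ 2 ≤ S.card ∧ S.card ≤ n - 2) ∧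
  ∀ S ∈ F, ∀ T ∈ F, S ⊆ T ∨ T ⊆ S ∨ S ∩ T = ∅

/-- The number `c` of components of the forest representation of a face `F` of `Δ_n`:
maximal elements of `F` plus elements of `{2,…,n}` lying in no member of `F`. -/
def whComps (n : ℕ) (F : Finset (Finset ℕ)) : ℕ :=
  (F.filter (fun S => ∀ U ∈ F, ¬ S ⊂ U)).card +
  ((Finset.Icc 2 n).filter (fun i => ∀ S ∈ F, i ∉ S)).card

/-- The number `c(T)` of children of the node `T` in the forest representation of `F`:
maximal elements of `{S ∈ F : S ⊊ T}` plus elements of `T` in no `S ∈ F` with `S ⊊ T`. -/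
def whChildren (F : Finset (Finset ℕ)) (T : Finset ℕ) : ℕ :=
  (F.filter (fun S => S ⊂ T ∧ ∀ U ∈ F, U ⊂ T → ¬ S ⊂ U)).card +
  (T.filter (fun i => ∀ S ∈ F, S ⊂ T → i ∉ S)).card

/-- A face of the join `Δ_{c+1} * (⋆_{T ∈ F} Δ_{c(T)+1})`, realized on the vertex set
`Option (Finset ℕ) × Finset ℕ`: the tag `none` marks the copy of `Δ_{whComps n F + 1}`
and the tag `some T` (for `T ∈ F`) marks the copy of `Δ_{whChildren F T + 1}`;
the vertex sets of the joined complexes are thus pairwise disjoint. -/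
def IsWhMultiJoinFace (n : ℕ) (F : Finset (Finset ℕ))
    (G : Finset (Option (Finset ℕ) × Finset ℕ)) : Prop :=
  (∀ p ∈ G, p.1 = none ∨ ∃ T ∈ F, p.1 = some T) ∧
  IsWhFace (whComps n F + 1) ((G.filter (fun p => p.1 = none)).image Prod.snd) ∧
  ∀ T ∈ F, IsWhFace (whChildren F T + 1)
    ((G.filter (fun p => p.1 = some T)).image Prod.snd)

/-- Two finite sets are nested or disjoint. -/
def NestedOrDisjoint (S T : Finset ℕ) : Prop := S ⊆ T ∨ T ⊆ S ∨ S ∩ T = ∅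

theorem NestedOrDisjoint.symm {S T : Finset ℕ} (h : NestedOrDisjoint S T) :
    NestedOrDisjoint T S := by
  rcases h with h | h | h
  · exact .inr (.inl h)
  · exact .inl h
  · exact .inr (.inr (by rwa [Finset.inter_comm]))

/-- The size condition on a vertex of `Δ_n`. -/
def IsWhVertex (n : ℕ) (S : Finset ℕ) : Prop :=
  S ⊆ Finset.Icc 2 n ∧ 2 ≤ S.card ∧ S.card ≤ n - 2

theorem isWhFace_iff {n : ℕ} {F : Finset (Finset ℕ)} :
    IsWhFace n F ↔
      (∀ S ∈ F, IsWhVertex n S) ∧ ∀ S ∈ F, ∀ T ∈ F, NestedOrDisjoint S T :=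
  Iff.rfl

theorem IsWhVertex.ssubset_Icc {n : ℕ} {S : Finset ℕ} (h : IsWhVertex n S) :
    S ⊂ Finset.Icc 2 n := by
  refine h.1.ssubset_of_ne ?_
  rintro rfl
  obtain ⟨-, h2, h3⟩ := h
  rw [Nat.card_Icc] at h2 h3
  omega

theorem IsWhVertex.nonempty {n : ℕ} {S : Finset ℕ} (h : IsWhVertex n S) : S.Nonempty :=
  Finset.card_pos.1 (by have := h.2.1; omega)

theorem isWhFace_insert_iff {n : ℕ} {F : Finset (Finset ℕ)} (hF : IsWhFace n F)
    {S : Finset ℕ} :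
    IsWhFace n (insert S F) ↔ IsWhVertex n S ∧ ∀ U ∈ F, NestedOrDisjoint S U := by
  rw [isWhFace_iff] at *
  constructor
  · rintro ⟨h1, h2⟩
    exact ⟨h1 S (Finset.mem_insert_self _ _), fun U hU =>
      h2 S (Finset.mem_insert_self _ _) U (Finset.mem_insert_of_mem hU)⟩
  · rintro ⟨h1, h2⟩
    refine ⟨fun U hU => ?_, fun U hU V hV => ?_⟩
    · rcases Finset.mem_insert.1 hU with rfl | hU
      exacts [h1, hF.1 U hU]
    · rcases Finset.mem_insert.1 hU with h | hU <;> rcases Finset.mem_insert.1 hV with h' | hV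
      exacts [.inl (h.trans h'.symm).subset, h ▸ h2 V hV, h' ▸ (h2 U hU).symm, hF.2 U hU V hV]

theorem isWhFace_union_iff {n : ℕ} {F G : Finset (Finset ℕ)} (hF : IsWhFace n F)
    (hG : ∀ S ∈ G, IsWhFace n (insert S F)) :
    IsWhFace n (F ∪ G) ↔ ∀ S ∈ G, ∀ T ∈ G, NestedOrDisjoint S T := by
  have hG' := fun S hS => (isWhFace_insert_iff hF).1 (hG S hS)
  rw [isWhFace_iff] at *
  constructor
  · exact fun h S hS T hT =>
      h.2 S (Finset.mem_union_right _ hS) T (Finset.mem_union_right _ hT)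
  · refine fun h => ⟨fun U hU => ?_, fun U hU V hV => ?_⟩
    · rcases Finset.mem_union.1 hU with hU | hU
      exacts [hF.1 U hU, (hG' U hU).1]
    · rcases Finset.mem_union.1 hU with hU | hU <;> rcases Finset.mem_union.1 hV with hV | hV
      exacts [hF.2 U hU V hV, ((hG' V hV).2 U hU).symm, (hG' U hU).2 V hV, h U hU V hV]

/-- The children of a node `T` of the forest of `F`, with leaves viewed as singletons. -/
def whBlocks (F : Finset (Finset ℕ)) (T : Finset ℕ) : Finset (Finset ℕ) :=
  F.filter (fun S => S ⊂ T ∧ ∀ U ∈ F, U ⊂ T → ¬ S ⊂ U) ∪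
    (T.filter (fun i => ∀ S ∈ F, S ⊂ T → i ∉ S)).image singleton

section Blocks

variable {F : Finset (Finset ℕ)} {T b b' : Finset ℕ}

theorem mem_whBlocks :
    b ∈ whBlocks F T ↔ (b ∈ F ∧ b ⊂ T ∧ ∀ U ∈ F, U ⊂ T → ¬ b ⊂ U) ∨
      ∃ i ∈ T, (∀ S ∈ F, S ⊂ T → i ∉ S) ∧ {i} = b := by
  simp only [whBlocks, Finset.mem_union, Finset.mem_filter, Finset.mem_image, and_assoc]

theorem card_whBlocks (hF : ∀ S ∈ F, 2 ≤ S.card) :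
    (whBlocks F T).card = whChildren F T := by
  rw [whBlocks, Finset.card_union_of_disjoint, whChildren,
    Finset.card_image_of_injective _ Finset.singleton_injective]
  rw [Finset.disjoint_left]
  intro S hS hS'
  obtain ⟨i, -, rfl⟩ := Finset.mem_image.1 hS'
  have := hF _ (Finset.mem_filter.1 hS).1
  simp at this

theorem subset_of_mem_whBlocks (hb : b ∈ whBlocks F T) : b ⊆ T := by
  rcases mem_whBlocks.1 hb with ⟨-, h, -⟩ | ⟨i, hi, -, rfl⟩
  exacts [h.subset, Finset.singleton_subset_iff.2 hi]

theorem nonempty_of_mem_whBlocks (hF : ∀ S ∈ F, S.Nonempty) (hb : b ∈ whBlocks F T) :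
    b.Nonempty := by
  rcases mem_whBlocks.1 hb with ⟨h, -⟩ | ⟨i, -, -, rfl⟩
  exacts [hF b h, Finset.singleton_nonempty i]

theorem exists_whBlock_superset {S : Finset ℕ} (hS : S ∈ F) (hST : S ⊂ T) :
    ∃ b ∈ whBlocks F T, S ⊆ b := by
  obtain ⟨b, hSb, hb⟩ := (F.filter (· ⊂ T)).exists_le_maximal (Finset.mem_filter.2 ⟨hS, hST⟩)
  have hbF := Finset.mem_filter.1 hb.prop
  refine ⟨b, mem_whBlocks.2 (.inl ⟨hbF.1, hbF.2, fun U hU hUT hbU => ?_⟩), hSb⟩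
  exact hb.not_gt (Finset.mem_filter.2 ⟨hU, hUT⟩) hbU

theorem exists_whBlock_mem {i : ℕ} (hi : i ∈ T) : ∃ b ∈ whBlocks F T, i ∈ b := by
  by_cases h : ∀ S ∈ F, S ⊂ T → i ∉ S
  · exact ⟨{i}, mem_whBlocks.2 (.inr ⟨i, hi, h, rfl⟩), Finset.mem_singleton_self i⟩
  · push Not at h
    obtain ⟨S, hS, hST, hiS⟩ := h
    obtain ⟨b, hb, hSb⟩ := exists_whBlock_superset hS hST
    exact ⟨b, hb, hSb hiS⟩

theorem whBlock_subset_or_disjoint {S : Finset ℕ} (hS : ∀ U ∈ F, NestedOrDisjoint S U)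
    (hST : ∀ U ∈ F, U ⊂ T → ¬ S ⊂ U) (hb : b ∈ whBlocks F T) :
    b ⊆ S ∨ b ∩ S = ∅ := by
  rcases mem_whBlocks.1 hb with ⟨hbF, hbT, -⟩ | ⟨i, -, -, rfl⟩
  · rcases hS b hbF with h | h | h
    · rcases h.eq_or_ssubset with rfl | h
      exacts [.inl subset_rfl, absurd h (hST b hbF hbT)]
    · exact .inl h
    · exact .inr (by rwa [Finset.inter_comm])
  · by_cases h : i ∈ S
    · exact .inl (Finset.singleton_subset_iff.2 h)
    · exact .inr (Finset.singleton_inter_of_notMem h)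

theorem whBlocks_eq_of_mem (hF : ∀ S ∈ F, ∀ U ∈ F, NestedOrDisjoint S U)
    (hb : b ∈ whBlocks F T) (hb' : b' ∈ whBlocks F T) {i : ℕ} (hi : i ∈ b) (hi' : i ∈ b') :
    b = b' := by
  have key : ∀ {c c' : Finset ℕ}, c ∈ whBlocks F T → c' ∈ whBlocks F T → i ∈ c → i ∈ c' →
      c ⊆ c' := by
    intro c c' hc hc' hi hi'
    rcases mem_whBlocks.1 hc' with ⟨hcF, -, hmax⟩ | ⟨j, hj, hj', rfl⟩
    · rcases whBlock_subset_or_disjoint (hF c' hcF) hmax hc with h | h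
      · exact h
      · exact absurd (Finset.mem_inter.2 ⟨hi, hi'⟩) (by simp [h])
    · obtain rfl := Finset.mem_singleton.1 hi'
      rcases mem_whBlocks.1 hc with ⟨hcF, hcT, -⟩ | ⟨k, -, -, rfl⟩
      · exact absurd hi (hj' c hcF hcT)
      · rw [Finset.mem_singleton.1 hi]
  exact (key hb hb' hi hi').antisymm (key hb' hb hi' hi)

theorem exists_bijOn_whBlocks (hF : ∀ S ∈ F, 2 ≤ S.card) (T : Finset ℕ) :
    ∃ f : Finset ℕ → ℕ, Set.BijOn f (whBlocks F T) (Finset.Icc 2 (whChildren F T + 1)) := by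
  refine (whBlocks F T).finite_toSet.exists_bijOn_of_encard_eq ?_
  rw [Set.encard_coe_eq_coe_finsetCard, Set.encard_coe_eq_coe_finsetCard, card_whBlocks hF,
    Nat.card_Icc]
  congr 1

end Blocks

theorem whComps_eq_whChildren {n : ℕ} {F : Finset (Finset ℕ)} (hF : IsWhFace n F) :
    whComps n F = whChildren F (Finset.Icc 2 n) := by
  have h : ∀ S ∈ F, S ⊂ Finset.Icc 2 n := fun S hS => IsWhVertex.ssubset_Icc (hF.1 S hS)
  unfold whComps whChildren
  congr 2
  · refine Finset.filter_congr fun S hS => ?_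
    exact ⟨fun H => ⟨h S hS, fun U hU _ => H U hU⟩, fun H U hU => H.2 U hU (h U hU)⟩
  · refine Finset.filter_congr fun i _ => ?_
    exact ⟨fun H S hS _ => H S hS, fun H S hS => H S hS (h S hS)⟩

/-- The tag of a node of the forest of a face of `Δ_n`, the root `{2,…,n}` being tagged `none`. -/
def whTag (n : ℕ) (T : Finset ℕ) : Option (Finset ℕ) :=
  if T = Finset.Icc 2 n then none else some T

theorem whTag_injective (n : ℕ) : Function.Injective (whTag n) := by
  intro T U h
  unfold whTag at h
  split_ifs at h with h1 h2
  · rw [h1, h2]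
  · exact Option.some_injective _ h

theorem isWhMultiJoinFace_iff {n : ℕ} {F : Finset (Finset ℕ)} (hF : IsWhFace n F)
    {G : Finset (Option (Finset ℕ) × Finset ℕ)} :
    IsWhMultiJoinFace n F G ↔
      (∀ p ∈ G, ∃ T ∈ insert (Finset.Icc 2 n) F, p.1 = whTag n T ∧
        IsWhVertex (whChildren F T + 1) p.2) ∧
      ∀ p ∈ G, ∀ q ∈ G, p.1 = q.1 → NestedOrDisjoint p.2 q.2 := by
  have htag : ∀ T ∈ F, whTag n T = some T := fun T hT =>
    if_neg (IsWhVertex.ssubset_Icc (hF.1 T hT)).ne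
  have hroot : whTag n (Finset.Icc 2 n) = none := if_pos rfl
  have himage : ∀ (o : Option (Finset ℕ)) (A : Finset ℕ),
      A ∈ (G.filter (fun p => p.1 = o)).image Prod.snd ↔ (o, A) ∈ G := by
    intro o A
    simp
  simp only [IsWhMultiJoinFace, isWhFace_iff, himage, whComps_eq_whChildren hF]
  constructor
  · rintro ⟨h1, ⟨h2, h2'⟩, h3⟩
    refine ⟨?_, ?_⟩
    · rintro ⟨o, A⟩ hp
      rcases h1 _ hp with h | ⟨T, hT, h⟩ <;> obtain rfl : o = _ := h
      · exact ⟨_, Finset.mem_insert_self _ _, hroot.symm, h2 A hp⟩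
      · exact ⟨T, Finset.mem_insert_of_mem hT, (htag T hT).symm, (h3 T hT).1 A hp⟩
    · rintro ⟨o, A⟩ hp ⟨o', B⟩ hq h
      obtain rfl : o = o' := h
      rcases h1 _ hp with h | ⟨T, hT, h⟩ <;> obtain rfl : o = _ := h
      · exact h2' A hp B hq
      · exact (h3 T hT).2 A hp B hq
  · rintro ⟨h1, h2⟩
    have key : ∀ T ∈ insert (Finset.Icc 2 n) F,
        (∀ A, (whTag n T, A) ∈ G → IsWhVertex (whChildren F T + 1) A) ∧
        ∀ A, (whTag n T, A) ∈ G → ∀ B, (whTag n T, B) ∈ G → NestedOrDisjoint A B := by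
      refine fun T hT => ⟨fun A hA => ?_, fun A hA B hB => h2 _ hA _ hB rfl⟩
      obtain ⟨U, hU, hUT, hA'⟩ := h1 _ hA
      obtain rfl := whTag_injective n hUT
      exact hA'
    refine ⟨fun p hp => ?_, ?_, fun T hT => ?_⟩
    · obtain ⟨T, hT, hpT, -⟩ := h1 p hp
      rcases Finset.mem_insert.1 hT with rfl | hT
      · exact .inl (hpT.trans hroot)
      · exact .inr ⟨T, hT, hpT.trans (htag T hT)⟩
    · have := key _ (Finset.mem_insert_self _ _)
      rwa [hroot] at this
    · have := key T (Finset.mem_insert_of_mem hT)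
      rwa [htag T hT] at this

/-- `T` is the smallest node of the forest of `F` strictly containing `S`. -/
def IsWhParent (n : ℕ) (F : Finset (Finset ℕ)) (S T : Finset ℕ) : Prop :=
  T ∈ insert (Finset.Icc 2 n) F ∧ S ⊂ T ∧ ∀ U ∈ insert (Finset.Icc 2 n) F, S ⊂ U → T ⊆ U

section Parent

variable {n : ℕ} {F : Finset (Finset ℕ)} {S S' T T' : Finset ℕ}

theorem IsWhParent.eq (h : IsWhParent n F S T) (h' : IsWhParent n F S T') : T = T' :=
  (h.2.2 T' h'.1 h'.2.1).antisymm (h'.2.2 T h.1 h.2.1)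

theorem IsWhParent.not_ssubset (h : IsWhParent n F S T) : ∀ U ∈ F, U ⊂ T → ¬ S ⊂ U :=
  fun U hU hUT hSU => hUT.not_subset (h.2.2 U (Finset.mem_insert_of_mem hU) hSU)

theorem nestedOrDisjoint_of_mem_nodes (hF : IsWhFace n F)
    (hT : T ∈ insert (Finset.Icc 2 n) F) (hT' : T' ∈ insert (Finset.Icc 2 n) F) :
    NestedOrDisjoint T T' := by
  rcases Finset.mem_insert.1 hT with rfl | hT <;> rcases Finset.mem_insert.1 hT' with rfl | hT'
  · exact .inl subset_rfl
  · exact .inr (.inl (hF.1 T' hT').1)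
  · exact .inl (hF.1 T hT).1
  · exact hF.2 T hT T' hT'

theorem exists_isWhParent (hF : IsWhFace n F) (hS : IsWhVertex n S) :
    ∃ T, IsWhParent n F S T := by
  obtain ⟨T, -, hT⟩ := ((insert (Finset.Icc 2 n) F).filter (S ⊂ ·)).exists_le_minimal
    (Finset.mem_filter.2 ⟨Finset.mem_insert_self _ _, hS.ssubset_Icc⟩)
  have hTF := Finset.mem_filter.1 hT.prop
  refine ⟨T, hTF.1, hTF.2, fun U hU hSU => ?_⟩
  rcases nestedOrDisjoint_of_mem_nodes hF hTF.1 hU with h | h | h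
  · exact h
  · exact hT.le_of_le (Finset.mem_filter.2 ⟨hU, hSU⟩) h
  · obtain ⟨i, hi⟩ := hS.nonempty
    exact absurd (Finset.mem_inter.2 ⟨hTF.2.subset hi, hSU.subset hi⟩) (by simp [h])

theorem nestedOrDisjoint_of_parent_ne (hF : IsWhFace n F)
    (hS : S ∉ F ∧ IsWhFace n (insert S F)) (hS' : S' ∉ F ∧ IsWhFace n (insert S' F))
    (h : IsWhParent n F S T) (h' : IsWhParent n F S' T') (hne : T ≠ T') :
    NestedOrDisjoint S S' := by
  have key : ∀ {S S' T T' : Finset ℕ}, (S' ∉ F ∧ IsWhFace n (insert S' F)) →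
      IsWhParent n F S T → IsWhParent n F S' T' → T ⊂ T' → NestedOrDisjoint S S' := by
    intro S S' T T' hS' h h' hTT'
    have hTF : T ∈ F := by
      refine (Finset.mem_insert.1 h.1).resolve_left ?_
      rintro rfl
      exact hTT'.not_subset (h'.2.2 _ (Finset.mem_insert_self _ _)
        ((isWhFace_insert_iff hF).1 hS'.2).1.ssubset_Icc)
    rcases ((isWhFace_insert_iff hF).1 hS'.2).2 T hTF with hc | hc | hc
    · refine absurd (hc.ssubset_of_ne ?_) (h'.not_ssubset T hTF hTT')
      rintro rfl
      exact hS'.1 hTF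
    · exact .inl (h.2.1.subset.trans hc)
    · refine .inr (.inr (Finset.subset_empty.1 ?_))
      rw [← hc, Finset.inter_comm]
      exact Finset.inter_subset_inter_left h.2.1.subset
  rcases nestedOrDisjoint_of_mem_nodes hF h.1 h'.1 with hc | hc | hc
  · exact key hS' h h' (hc.ssubset_of_ne hne)
  · exact (key hS h' h (hc.ssubset_of_ne hne.symm)).symm
  · refine .inr (.inr (Finset.subset_empty.1 ?_))
    rw [← hc]
    exact Finset.inter_subset_inter h.2.1.subset h'.2.1.subset

end Parent

/-- The labels under `f` of the children of `T` contained in `S`. -/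
def whLabels (F : Finset (Finset ℕ)) (f : Finset ℕ → ℕ) (T S : Finset ℕ) : Finset ℕ :=
  ((whBlocks F T).filter (· ⊆ S)).image f

section Labels

variable {n : ℕ} {F : Finset (Finset ℕ)} {f : Finset ℕ → ℕ} {S S' T : Finset ℕ}

theorem apply_mem_whLabels (hf : Set.InjOn f (whBlocks F T)) {b : Finset ℕ}
    (hb : b ∈ whBlocks F T) : f b ∈ whLabels F f T S ↔ b ⊆ S := by
  simp only [whLabels, Finset.mem_image, Finset.mem_filter]
  constructor
  · rintro ⟨c, ⟨hc, hcS⟩, h⟩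
    rwa [← hf hc hb h]
  · exact fun h => ⟨b, ⟨hb, h⟩, rfl⟩

theorem card_whLabels (hf : Set.InjOn f (whBlocks F T)) :
    (whLabels F f T S).card = ((whBlocks F T).filter (· ⊆ S)).card :=
  Finset.card_image_of_injOn (hf.mono (Finset.coe_subset.2 (Finset.filter_subset _ _)))

theorem exists_whBlock_subset (hF : IsWhFace n F) (hS : IsWhFace n (insert S F))
    (h : IsWhParent n F S T) {i : ℕ} (hi : i ∈ S) :
    ∃ b ∈ whBlocks F T, b ⊆ S ∧ i ∈ b := by
  obtain ⟨b, hb, hib⟩ := exists_whBlock_mem (F := F) (h.2.1.subset hi)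
  refine ⟨b, hb, ?_, hib⟩
  rcases whBlock_subset_or_disjoint ((isWhFace_insert_iff hF).1 hS).2 h.not_ssubset hb with hc | hc
  · exact hc
  · exact absurd (Finset.mem_inter.2 ⟨hib, hi⟩) (by simp [hc])

theorem whLabels_subset_iff (hF : IsWhFace n F) (hf : Set.InjOn f (whBlocks F T))
    (hS : IsWhFace n (insert S F)) (h : IsWhParent n F S T) :
    whLabels F f T S ⊆ whLabels F f T S' ↔ S ⊆ S' := by
  constructor
  · intro hsub i hi
    obtain ⟨b, hb, hbS, hib⟩ := exists_whBlock_subset hF hS h hi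
    exact (apply_mem_whLabels hf hb).1 (hsub ((apply_mem_whLabels hf hb).2 hbS)) hib
  · intro hsub
    exact Finset.image_subset_image
      (Finset.monotone_filter_right _ fun b _ hb => hb.trans hsub)

theorem whLabels_inter_eq_empty_iff (hF : IsWhFace n F) (hf : Set.InjOn f (whBlocks F T))
    (hS : IsWhFace n (insert S F)) (h : IsWhParent n F S T)
    (hS' : IsWhFace n (insert S' F)) (h' : IsWhParent n F S' T) :
    whLabels F f T S ∩ whLabels F f T S' = ∅ ↔ S ∩ S' = ∅ := by
  simp only [Finset.eq_empty_iff_forall_notMem, Finset.mem_inter, not_and]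
  constructor
  · intro hd i hi hi'
    obtain ⟨b, hb, hbS, hib⟩ := exists_whBlock_subset hF hS h hi
    obtain ⟨b', hb', hbS', hib'⟩ := exists_whBlock_subset hF hS' h' hi'
    obtain rfl := whBlocks_eq_of_mem hF.2 hb hb' hib hib'
    exact hd (f b) ((apply_mem_whLabels hf hb).2 hbS) ((apply_mem_whLabels hf hb).2 hbS')
  · intro hd a ha ha'
    obtain ⟨b, hb, rfl⟩ := Finset.mem_image.1 ha
    have hb := (Finset.mem_filter.1 hb).1
    obtain ⟨i, hi⟩ := nonempty_of_mem_whBlocks (fun U hU => IsWhVertex.nonempty (hF.1 U hU)) hb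
    exact hd i ((apply_mem_whLabels hf hb).1 ha hi) ((apply_mem_whLabels hf hb).1 ha' hi)

theorem nestedOrDisjoint_whLabels_iff (hF : IsWhFace n F) (hf : Set.InjOn f (whBlocks F T))
    (hS : IsWhFace n (insert S F)) (h : IsWhParent n F S T)
    (hS' : IsWhFace n (insert S' F)) (h' : IsWhParent n F S' T) :
    NestedOrDisjoint (whLabels F f T S) (whLabels F f T S') ↔ NestedOrDisjoint S S' := by
  unfold NestedOrDisjoint
  rw [whLabels_subset_iff hF hf hS h, whLabels_subset_iff hF hf hS' h',
    whLabels_inter_eq_empty_iff hF hf hS h hS' h']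

theorem isWhVertex_whLabels (hF : IsWhFace n F)
    (hf : Set.BijOn f (whBlocks F T) (Finset.Icc 2 (whChildren F T + 1)))
    (hS : S ∉ F ∧ IsWhFace n (insert S F)) (h : IsWhParent n F S T) :
    IsWhVertex (whChildren F T + 1) (whLabels F f T S) := by
  have hSv := ((isWhFace_insert_iff hF).1 hS.2).1
  refine ⟨?_, ?_, ?_⟩
  · intro a ha
    obtain ⟨b, hb, rfl⟩ := Finset.mem_image.1 ha
    exact hf.mapsTo (Finset.mem_filter.1 hb).1
  · rw [card_whLabels hf.injOn]
    by_contra! hlt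
    obtain ⟨i, hi⟩ := hSv.nonempty
    obtain ⟨b, hb, hbS, hib⟩ := exists_whBlock_subset hF hS.2 h hi
    have hSb : S = b := by
      refine Finset.Subset.antisymm (fun j hj => ?_) hbS
      obtain ⟨c, hc, hcS, hjc⟩ := exists_whBlock_subset hF hS.2 h hj
      rwa [Finset.card_le_one.1 (Nat.le_of_lt_succ hlt) b (Finset.mem_filter.2 ⟨hb, hbS⟩) c
        (Finset.mem_filter.2 ⟨hc, hcS⟩)]
    subst hSb
    rcases mem_whBlocks.1 hb with ⟨hSF, -⟩ | ⟨j, -, -, rfl⟩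
    · exact hS.1 hSF
    · have := hSv.2.1
      simp at this
  · rw [card_whLabels hf.injOn]
    have hlt : ((whBlocks F T).filter (· ⊆ S)).card < (whBlocks F T).card := by
      refine Finset.card_lt_card (Finset.filter_ssubset.2 ?_)
      obtain ⟨i, hiT, hiS⟩ := Finset.exists_of_ssubset h.2.1
      obtain ⟨b, hb, hib⟩ := exists_whBlock_mem (F := F) hiT
      exact ⟨b, hb, fun hbS => hiS (hbS hib)⟩
    rw [card_whBlocks fun U hU => (hF.1 U hU).2.1] at hlt
    omega

theorem exists_whLabels_eq (hF : IsWhFace n F)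
    (hf : Set.BijOn f (whBlocks F T) (Finset.Icc 2 (whChildren F T + 1)))
    (hT : T ∈ insert (Finset.Icc 2 n) F) {A : Finset ℕ}
    (hA : IsWhVertex (whChildren F T + 1) A) :
    ∃ S, (S ∉ F ∧ IsWhFace n (insert S F)) ∧ IsWhParent n F S T ∧ whLabels F f T S = A := by
  set B := (whBlocks F T).filter (f · ∈ A) with hB
  set S := B.biUnion id with hSdef
  have hne : ∀ {b}, b ∈ whBlocks F T → b.Nonempty :=
    nonempty_of_mem_whBlocks fun U hU => IsWhVertex.nonempty (hF.1 U hU)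
  have hBS : ∀ {b}, b ∈ B → b ⊆ S := fun hb => Finset.subset_biUnion_of_mem id hb
  have hBmem : ∀ {b}, b ∈ B → b ∈ whBlocks F T := fun hb => (Finset.mem_filter.1 hb).1
  have hmeet : ∀ {b i}, b ∈ whBlocks F T → i ∈ b → i ∈ S → b ∈ B := by
    intro b i hb hib hiS
    obtain ⟨c, hc, hic⟩ := Finset.mem_biUnion.1 hiS
    rwa [whBlocks_eq_of_mem hF.2 hb (hBmem hc) hib hic]
  have himage : B.image f = A := by
    ext a
    simp only [hB, Finset.mem_image, Finset.mem_filter]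
    constructor
    · rintro ⟨b, ⟨-, h⟩, rfl⟩
      exact h
    · intro ha
      obtain ⟨b, hb, rfl⟩ := hf.surjOn (hA.1 ha)
      exact ⟨b, ⟨hb, ha⟩, rfl⟩
  have hBcard : B.card = A.card := by
    rw [← himage, Finset.card_image_of_injOn
      (hf.injOn.mono (Finset.coe_subset.2 (Finset.filter_subset _ _)))]
  obtain ⟨b₁, hb₁, b₂, hb₂, hb₁₂⟩ :=
    Finset.one_lt_card.1 (show 1 < B.card by have := hA.2.1; omega)
  obtain ⟨i₁, hi₁⟩ := hne (hBmem hb₁)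
  obtain ⟨i₂, hi₂⟩ := hne (hBmem hb₂)
  have hST : S ⊂ T := by
    refine Finset.ssubset_iff_subset_ne.2
      ⟨Finset.biUnion_subset.2 fun b hb => subset_of_mem_whBlocks (hBmem hb), fun heq => ?_⟩
    have hall : whBlocks F T ⊆ B := fun b hb => by
      obtain ⟨i, hi⟩ := hne hb
      exact hmeet hb hi (heq ▸ subset_of_mem_whBlocks hb hi)
    have hle := Finset.card_le_card hall
    rw [card_whBlocks fun U hU => (hF.1 U hU).2.1] at hle
    have h2 := hA.2.1
    have h3 := hA.2.2
    omega
  have hTn : T ⊆ Finset.Icc 2 n := by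
    rcases Finset.mem_insert.1 hT with rfl | hT
    exacts [subset_rfl, (hF.1 T hT).1]
  have hnot : ∀ U ∈ F, U ⊂ T → ¬ S ⊆ U := by
    intro U hU hUT hSU
    obtain ⟨b, hb, hUb⟩ := exists_whBlock_superset hU hUT
    refine hb₁₂ ((whBlocks_eq_of_mem hF.2 (hBmem hb₁) hb hi₁ ?_).trans
      (whBlocks_eq_of_mem hF.2 (hBmem hb₂) hb hi₂ ?_).symm)
    exacts [hUb (hSU (hBS hb₁ hi₁)), hUb (hSU (hBS hb₂ hi₂))]
  refine ⟨S, ⟨fun hSF => hnot S hSF hST subset_rfl, ?_⟩, ⟨hT, hST, ?_⟩, ?_⟩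
  · refine (isWhFace_insert_iff hF).2 ⟨⟨hST.subset.trans hTn, ?_, ?_⟩, fun U hU => ?_⟩
    · refine Finset.one_lt_card.2 ⟨i₁, hBS hb₁ hi₁, i₂, hBS hb₂ hi₂, ?_⟩
      rintro rfl
      exact hb₁₂ (whBlocks_eq_of_mem hF.2 (hBmem hb₁) (hBmem hb₂) hi₁ hi₂)
    · have := Finset.card_lt_card (hST.trans_subset hTn)
      rw [Nat.card_Icc] at this
      omega
    · rcases nestedOrDisjoint_of_mem_nodes hF hT (Finset.mem_insert_of_mem hU) with hc | hc | hc
      · exact .inl (hST.subset.trans hc)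
      · rcases hc.eq_or_ssubset with rfl | hc
        · exact .inl hST.subset
        · obtain ⟨b, hb, hUb⟩ := exists_whBlock_superset hU hc
          by_cases hbB : b ∈ B
          · exact .inr (.inl (hUb.trans (hBS hbB)))
          · refine .inr (.inr (Finset.eq_empty_of_forall_notMem fun i hi => hbB ?_))
            obtain ⟨hiS, hiU⟩ := Finset.mem_inter.1 hi
            exact hmeet hb (hUb hiU) hiS
      · refine .inr (.inr (Finset.subset_empty.1 ?_))
        rw [← hc]
        exact Finset.inter_subset_inter_right hST.subset
  · intro U hU hSU
    rcases nestedOrDisjoint_of_mem_nodes hF hT hU with hc | hc | hc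
    · exact hc
    · rcases hc.eq_or_ssubset with rfl | hc
      · exact subset_rfl
      · rcases Finset.mem_insert.1 hU with rfl | hU
        · exact absurd hTn hc.not_subset
        · exact absurd hSU.subset (hnot U hU hc)
    · have hi := hBS hb₁ hi₁
      exact absurd (Finset.mem_inter.2 ⟨hST.subset hi, hSU.subset hi⟩) (by simp [hc])
  · rw [← himage, whLabels]
    congr 1
    ext b
    constructor
    · intro hb
      obtain ⟨hb, hbS⟩ := Finset.mem_filter.1 hb
      obtain ⟨i, hi⟩ := hne hb
      exact hmeet hb hi (hbS hi)
    · exact fun hb => Finset.mem_filter.2 ⟨hBmem hb, hBS hb⟩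

end Labels

theorem stmt2 (n : ℕ) (hn : 3 ≤ n) (F : Finset (Finset ℕ)) (hF : IsWhFace n F) :
    ∃ φ : Finset ℕ → Option (Finset ℕ) × Finset ℕ,
      Set.BijOn φ
        {S : Finset ℕ | S ∉ F ∧ IsWhFace n (insert S F)}
        {v : Option (Finset ℕ) × Finset ℕ | IsWhMultiJoinFace n F {v}} ∧
      ∀ G : Finset (Finset ℕ),
        (∀ S ∈ G, S ∉ F ∧ IsWhFace n (insert S F)) →
        ((Disjoint F G ∧ IsWhFace n (F ∪ G)) ↔ IsWhMultiJoinFace n F (G.image φ)) := by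
  classical
  choose f hf using exists_bijOn_whBlocks fun S hS => (hF.1 S hS).2.1
  have hparent : ∀ S, ∃ T, IsWhFace n (insert S F) → IsWhParent n F S T := fun S => by
    by_cases hS : IsWhFace n (insert S F)
    · obtain ⟨T, hT⟩ := exists_isWhParent hF ((isWhFace_insert_iff hF).1 hS).1
      exact ⟨T, fun _ => hT⟩
    · exact ⟨∅, fun h => absurd h hS⟩
  choose par hpar using hparent
  refine ⟨fun S => (whTag n (par S), whLabels F (f (par S)) (par S) S), ⟨?_, ?_, ?_⟩, ?_⟩
  · intro S hS
    rw [Set.mem_ofPred_eq, isWhMultiJoinFace_iff hF]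
    refine ⟨fun p hp => ?_, fun p hp q hq _ => ?_⟩
    · obtain rfl := Finset.mem_singleton.1 hp
      exact ⟨par S, (hpar S hS.2).1, rfl, isWhVertex_whLabels hF (hf _) hS (hpar S hS.2)⟩
    · rw [Finset.mem_singleton.1 hp, Finset.mem_singleton.1 hq]
      exact .inl subset_rfl
  · intro S hS S' hS' heq
    obtain ⟨htag, hlab⟩ := Prod.mk.inj heq
    have hp := hpar S hS.2
    have hp' := hpar S' hS'.2
    rw [← whTag_injective n htag] at hlab hp'
    exact ((whLabels_subset_iff hF (hf _).injOn hS.2 hp).1 hlab.subset).antisymm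
      ((whLabels_subset_iff hF (hf _).injOn hS'.2 hp').1 hlab.symm.subset)
  · rintro ⟨o, A⟩ hv
    obtain ⟨T, hT, hoT, hA⟩ :=
      ((isWhMultiJoinFace_iff hF).1 hv).1 _ (Finset.mem_singleton_self _)
    obtain ⟨S, hS, hST, hlab⟩ := exists_whLabels_eq hF (hf T) hT hA
    refine ⟨S, hS, ?_⟩
    have hpT := (hpar S hS.2).eq hST
    simp only at hoT
    simp only [hpT, hoT, hlab]
  · intro G hG
    have hdisj : Disjoint F G := Finset.disjoint_right.2 fun S hS => (hG S hS).1
    rw [isWhFace_union_iff hF fun S hS => (hG S hS).2, isWhMultiJoinFace_iff hF]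
    simp only [Finset.forall_mem_image]
    constructor
    · rintro ⟨-, h⟩
      refine ⟨fun S hS => ⟨par S, (hpar S (hG S hS).2).1, rfl,
        isWhVertex_whLabels hF (hf _) (hG S hS) (hpar S (hG S hS).2)⟩, fun S hS S' hS' htag => ?_⟩
      have hp' := hpar S' (hG S' hS').2
      rw [← whTag_injective n htag] at hp' ⊢
      exact (nestedOrDisjoint_whLabels_iff hF (hf _).injOn (hG S hS).2 (hpar S (hG S hS).2)
        (hG S' hS').2 hp').2 (h S hS S' hS')
    · rintro ⟨-, h⟩
      refine ⟨hdisj, fun S hS S' hS' => ?_⟩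
      have hp := hpar S (hG S hS).2
      have hp' := hpar S' (hG S' hS').2
      by_cases heq : par S = par S'
      · have hlab := h hS hS' (congrArg (whTag n) heq)
        rw [← heq] at hlab hp'
        exact (nestedOrDisjoint_whLabels_iff hF (hf _).injOn (hG S hS).2 hp
          (hG S' hS').2 hp').1 hlab
      · exact nestedOrDisjoint_of_parent_ne hF (hG S hS) (hG S' hS') hp hp' heq
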